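/- arXiv:2402.05230 — 2 statements merged into one kernel-verified Lean document; each statement's English description precedes it below -/
import Mathlib

section
/- Suppose 0 < σ < n. Then lim_{ξ→0, ξ≠0} |ξ|^{−σ} M_{α,β}(ξ) = −(e^{−iφ}/Γ(β−α)) ∫₀^∞ φ₀(r) J̄_n(r) r^{−σ} dr, where 1/Γ(β−α) denotes the value of the entire reciprocal Gamma function at β−α. -/
open MeasureTheory Filter Real Complex Topology ENNReal

/-- The Mittag-Leffler function `E_{α,β}(z) = ∑_{k=0}^∞ z^k / Γ(αk + β)`. -/
noncomputable def mittagLeffler (a b : ℝ) (z : ℂ) : ℂ :=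
  ∑' k : ℕ, z ^ k / Complex.Gamma (((a * k + b : ℝ) : ℂ))

/-- The Bessel function of the first kind
`J_λ(r) = (2^{-λ} r^λ / (Γ(1/2) Γ(λ+1/2))) ∫_{-1}^1 e^{irs} (1-s²)^{λ-1/2} ds`. -/
noncomputable def besselJ (lam : ℂ) (r : ℝ) : ℂ :=
  (2 : ℂ) ^ (-lam) * (r : ℂ) ^ lam / (Complex.Gamma (1/2) * Complex.Gamma (lam + 1/2)) *
    ∫ s in (-1:ℝ)..1, Complex.exp (Complex.I * r * s) * (((1 - s ^ 2 : ℝ)) : ℂ) ^ (lam - 1/2)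

/-- `J_{-1/2}(r) = √(2/π) r^{-1/2} cos r`. -/
noncomputable def besselJNegHalf (r : ℝ) : ℂ :=
  ((Real.sqrt (2 / Real.pi) * r ^ (-(1/2) : ℝ) * Real.cos r : ℝ) : ℂ)

/-- `J̄_n(r) = J_{n/2-1}(2πr) r^{n/2}`, using `J_{-1/2}` when `n = 1`. -/
noncomputable def besselJbar (n : ℕ) (r : ℝ) : ℂ :=
  (if n = 1 then besselJNegHalf (2 * Real.pi * r)
    else besselJ ((n : ℂ) / 2 - 1) (2 * Real.pi * r)) * ((r ^ ((n : ℝ) / 2) : ℝ) : ℂ)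

/-- `M_{α,β}(ξ) = ∫₀^∞ φ₀(r) E_{α,β}(e^{iφ} r^σ/|ξ|^σ) J̄_n(r) dr`. -/
noncomputable def Mfun (n : ℕ) (a b s p : ℝ) (cut : ℝ → ℝ) (ξ : EuclideanSpace ℝ (Fin n)) : ℂ :=
  ∫ r in Set.Ioi (0:ℝ), ((cut r : ℝ) : ℂ) *
    mittagLeffler a b (Complex.exp (Complex.I * p) * ((r ^ s / ‖ξ‖ ^ s : ℝ) : ℂ)) *
    besselJbar n r


/-- The integrand `e^ζ ζ^{-γ} dζ` of Hankel's formula in the logarithmic variable `ζ = e^w`. -/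
noncomputable def hankelKernel (γ : ℝ) (w : ℂ) : ℂ :=
  Complex.exp (Complex.exp w + ((1 - γ : ℝ) : ℂ) * w)

/-- Integral of `f` over the horizontal ray `{x + iθ | x > L}`. -/
noncomputable def rayIntegral (θ L : ℝ) (f : ℂ → ℂ) : ℂ :=
  ∫ x in Set.Ioi L, f (x + θ * Complex.I)

/-- Integral of `f` along the boundary of the half-strip `{Re w > L, |Im w| < θ}`, which is a Hankel
contour in the logarithmic variable. -/
noncomputable def hankelIntegral (θ L : ℝ) (f : ℂ → ℂ) : ℂ :=
  rayIntegral θ L f - rayIntegral (-θ) L f +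
    Complex.I * ∫ y in (-θ)..θ, f (L + y * Complex.I)

/-- Integrability of `f` along both rays of the Hankel contour. -/
def RayIntegrable (θ L : ℝ) (f : ℂ → ℂ) : Prop :=
  IntegrableOn (fun x : ℝ => f (x + θ * Complex.I)) (Set.Ioi L)

lemma norm_hankelKernel (γ x y : ℝ) :
    ‖hankelKernel γ (x + y * Complex.I)‖ =
      Real.exp (Real.exp x * Real.cos y + (1 - γ) * x) := by
  rw [hankelKernel, Complex.norm_exp]
  congr 1
  simp [Complex.exp_re]

lemma differentiable_hankelKernel (γ : ℝ) : Differentiable ℂ (hankelKernel γ) := by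
  unfold hankelKernel
  fun_prop

lemma eventually_exp_mul_add_le_neg {c : ℝ} (hc : c < 0) (b : ℝ) :
    ∀ᶠ x : ℝ in atTop, Real.exp x * c + b * x ≤ -x := by
  filter_upwards [eventually_ge_atTop 0, eventually_ge_atTop (2 * (b + 1) / (-c))] with x h0 hx
  have h1 := Real.quadratic_le_exp_of_nonneg h0
  rw [div_le_iff₀ (by linarith)] at hx
  have h2 : x ^ 2 / 2 * (-c) ≤ Real.exp x * (-c) :=
    mul_le_mul_of_nonneg_right (by linarith) (by linarith)
  nlinarith

lemma rayIntegrable_hankelKernel {θ : ℝ} (hθ : Real.cos θ < 0) (γ L : ℝ) :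
    RayIntegrable θ L (hankelKernel γ) := by
  have hcont : Continuous fun x : ℝ => hankelKernel γ (x + θ * Complex.I) :=
    (differentiable_hankelKernel γ).continuous.comp (by fun_prop)
  refine (integrable_norm_iff hcont.aestronglyMeasurable).mp ?_
  refine integrable_of_isBigO_exp_neg one_pos hcont.norm.continuousOn ?_
  refine Asymptotics.IsBigO.of_bound 1 ?_
  filter_upwards [eventually_exp_mul_add_le_neg hθ (1 - γ)] with x hx
  rw [norm_hankelKernel, Real.norm_of_nonneg (Real.exp_pos _).le,
    Real.norm_of_nonneg (Real.exp_pos _).le, one_mul, Real.exp_le_exp]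
  linarith

lemma tendsto_exp_exp_mul_add {c : ℝ} (hc : c < 0) (b : ℝ) :
    Tendsto (fun x : ℝ => Real.exp (Real.exp x * c + b * x)) atTop (𝓝 0) := by
  refine squeeze_zero' (Eventually.of_forall fun x => (Real.exp_pos _).le) ?_
    Real.tendsto_exp_neg_atTop_nhds_zero
  filter_upwards [eventually_exp_mul_add_le_neg hc b] with x hx
  exact Real.exp_le_exp.mpr hx

/-- Cauchy's theorem on a half-strip truncated on the left. -/
lemma rayIntegral_sub_rayIntegral {f : ℂ → ℂ} (hf : Differentiable ℂ f) {a b L : ℝ} (hab : a ≤ b)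
    (ha : RayIntegrable a L f) (hb : RayIntegrable b L f) {B : ℝ → ℝ}
    (hB : ∀ x : ℝ, ∀ y ∈ Set.Icc a b, ‖f (x + y * Complex.I)‖ ≤ B x) (hB0 : Tendsto B atTop (𝓝 0)) :
    rayIntegral a L f - rayIntegral b L f =
      Complex.I * ∫ y in a..b, f (L + y * Complex.I) := by
  have hlim : Tendsto (fun R : ℝ => (∫ x in L..R, f (x + a * Complex.I)) -
      (∫ x in L..R, f (x + b * Complex.I)) +
      Complex.I * (∫ y in a..b, f (R + y * Complex.I))) atTop
      (𝓝 (rayIntegral a L f - rayIntegral b L f + Complex.I * 0)) := by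
    refine ((intervalIntegral_tendsto_integral_Ioi L ha tendsto_id).sub
      (intervalIntegral_tendsto_integral_Ioi L hb tendsto_id)).add (Tendsto.const_mul _ ?_)
    refine squeeze_zero_norm (a := fun R => B R * |b - a|) (fun R => ?_) ?_
    · refine intervalIntegral.norm_integral_le_of_norm_le_const fun y hy => hB R y ?_
      rw [Set.uIoc_of_le hab] at hy
      exact ⟨hy.1.le, hy.2⟩
    · simpa using hB0.mul_const |b - a|
  have hconst : ∀ R : ℝ, (∫ x in L..R, f (x + a * Complex.I)) -
      (∫ x in L..R, f (x + b * Complex.I)) + Complex.I * (∫ y in a..b, f (R + y * Complex.I)) =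
      Complex.I * ∫ y in a..b, f (L + y * Complex.I) := by
    intro R
    have h := Complex.integral_boundary_rect_eq_zero_of_differentiableOn f
      ⟨L, a⟩ ⟨R, b⟩ hf.differentiableOn
    simp only [smul_eq_mul] at h
    linear_combination h
  simp_rw [hconst] at hlim
  simpa using tendsto_nhds_unique hlim tendsto_const_nhds

/-- The Hankel integral of a function holomorphic on the half-strip does not depend on its left
end. -/
lemma hankelIntegral_eq_of_le {f : ℂ → ℂ} {θ L R : ℝ} (hθ : 0 ≤ θ) (hLR : L ≤ R)
    (hf : ∀ w : ℂ, |w.im| ≤ θ → DifferentiableAt ℂ f w)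
    (h1 : RayIntegrable θ L f) (h2 : RayIntegrable (-θ) L f) :
    hankelIntegral θ L f = hankelIntegral θ R f := by
  have h := Complex.integral_boundary_rect_eq_zero_of_differentiableOn f ⟨L, -θ⟩ ⟨R, θ⟩ (by
    intro w hw
    refine (hf w ?_).differentiableWithinAt
    have := hw.2
    simp only [Set.mem_preimage] at this
    rw [Set.uIcc_of_le (by linarith)] at this
    exact abs_le.mpr this)
  have e1 := intervalIntegral.integral_Ioi_sub_Ioi h1 hLR
  have e2 := intervalIntegral.integral_Ioi_sub_Ioi h2 hLR
  simp only [smul_eq_mul] at h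
  unfold hankelIntegral rayIntegral
  linear_combination e1 - e2 - h

/-- The Hankel integral of the kernel does not depend on the opening angle. -/
lemma hankelIntegral_hankelKernel_eq_pi {θ : ℝ} (h1 : Real.pi / 2 < θ) (h2 : θ ≤ Real.pi)
    (γ L : ℝ) :
    hankelIntegral θ L (hankelKernel γ) = hankelIntegral Real.pi L (hankelKernel γ) := by
  have hpi := Real.pi_pos
  have hc : Real.cos θ < 0 := Real.cos_neg_of_pi_div_two_lt_of_lt h1 (by linarith)
  have hcos : ∀ y, θ ≤ |y| → |y| ≤ Real.pi → Real.cos y ≤ Real.cos θ := fun y h h' => by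
    rw [← Real.cos_abs y]
    exact Real.cos_le_cos_of_nonneg_of_le_pi (by linarith) h' h
  have hbd : ∀ x y : ℝ, θ ≤ |y| → |y| ≤ Real.pi → ‖hankelKernel γ (x + y * Complex.I)‖ ≤
      Real.exp (Real.exp x * Real.cos θ + (1 - γ) * x) := fun x y h h' => by
    rw [norm_hankelKernel]
    gcongr
    exact hcos y h h'
  have hint : ∀ y, θ ≤ |y| → |y| ≤ Real.pi → RayIntegrable y L (hankelKernel γ) :=
    fun y h h' => rayIntegrable_hankelKernel ((hcos y h h').trans_lt hc) γ L
  have habs : |θ| = θ := abs_of_pos (by linarith)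
  have habs' : |Real.pi| = Real.pi := abs_of_pos hpi
  have e1 := rayIntegral_sub_rayIntegral (differentiable_hankelKernel γ) h2
    (hint θ (by rw [habs]) (by rwa [habs])) (hint Real.pi (by rwa [habs']) habs'.le)
    (fun x y hy => by
      have : |y| = y := abs_of_pos (by linarith [hy.1])
      exact hbd x y (by linarith [hy.1]) (by linarith [hy.2])) (tendsto_exp_exp_mul_add hc _)
  have e2 := rayIntegral_sub_rayIntegral (differentiable_hankelKernel γ) (neg_le_neg h2)
    (hint (-Real.pi) (by rwa [abs_neg, habs']) (by rw [abs_neg, habs']))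
    (hint (-θ) (by rw [abs_neg, habs]) (by rwa [abs_neg, habs]))
    (fun x y hy => by
      have : |y| = -y := abs_of_neg (by linarith [hy.2])
      exact hbd x y (by linarith [hy.2]) (by linarith [hy.1])) (tendsto_exp_exp_mul_add hc _)
  have hii : ∀ a b : ℝ, IntervalIntegrable
      (fun y : ℝ => hankelKernel γ (L + y * Complex.I)) volume a b := fun a b =>
    ((differentiable_hankelKernel γ).continuous.comp (by fun_prop)).intervalIntegrable _ _
  have e3 := intervalIntegral.integral_add_adjacent_intervals (hii (-Real.pi) (-θ)) (hii (-θ) θ)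
  have e4 := intervalIntegral.integral_add_adjacent_intervals (hii (-Real.pi) θ) (hii θ Real.pi)
  unfold hankelIntegral
  linear_combination e1 + e2 + Complex.I * e3 + Complex.I * e4

lemma tendsto_rayIntegral_real {a : ℝ} (ha : 0 < a) :
    Tendsto (fun L : ℝ => ∫ x in Set.Ioi L, Real.exp (-Real.exp x + a * x)) atBot
      (𝓝 (Real.Gamma a)) := by
  have h1 := (MeasureTheory.IntegrableOn.continuousWithinAt_Ici_primitive_Ioi
    (Real.GammaIntegral_convergent ha)).tendsto
  rw [← Real.Gamma_eq_integral ha] at h1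
  have h2 : Tendsto Real.exp atBot (𝓝[≥] 0) :=
    Real.tendsto_exp_atBot_nhdsGT.mono_right (nhdsWithin_mono _ Set.Ioi_subset_Ici_self)
  refine (h1.comp h2).congr fun L => ?_
  rw [Function.comp_apply, ← integral_comp_exp_Ioi]
  refine integral_congr_ae (Eventually.of_forall fun x => ?_)
  simp only [smul_eq_mul]
  rw [← Real.exp_mul, ← Real.exp_add, ← Real.exp_add]
  congr 1
  ring

lemma hankelKernel_of_sin_eq_zero {θ : ℝ} (hc : Complex.cos θ = -1) (hs : Complex.sin θ = 0)
    (γ x : ℝ) :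
    hankelKernel γ (x + θ * Complex.I) = Complex.exp ((1 - γ : ℝ) * θ * Complex.I) *
      ((Real.exp (-Real.exp x + (1 - γ) * x) : ℝ) : ℂ) := by
  have h : Complex.exp (θ * Complex.I) = -1 := by simp [Complex.exp_mul_I, hc, hs]
  rw [hankelKernel, Complex.exp_add x, h, Complex.ofReal_exp, ← Complex.exp_add]
  push_cast
  congr 1
  ring

lemma rayIntegral_hankelKernel_of_sin_eq_zero {θ : ℝ} (hc : Complex.cos θ = -1)
    (hs : Complex.sin θ = 0) (γ L : ℝ) :
    rayIntegral θ L (hankelKernel γ) = Complex.exp ((1 - γ : ℝ) * θ * Complex.I) *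
      ((∫ x in Set.Ioi L, Real.exp (-Real.exp x + (1 - γ) * x) : ℝ) : ℂ) := by
  simp_rw [rayIntegral, hankelKernel_of_sin_eq_zero hc hs]
  rw [integral_const_mul, integral_complex_ofReal]

lemma hankelIntegral_pi_eq (γ L R : ℝ) :
    hankelIntegral Real.pi L (hankelKernel γ) = hankelIntegral Real.pi R (hankelKernel γ) := by
  wlog h : L ≤ R
  · exact (this γ R L (le_of_not_ge h)).symm
  exact hankelIntegral_eq_of_le Real.pi_pos.le h (fun w _ => differentiable_hankelKernel γ w)
    (rayIntegrable_hankelKernel (by simp) γ L) (rayIntegrable_hankelKernel (by simp) γ L)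

lemma tendsto_arc_of_lt_one {γ : ℝ} (hγ : γ < 1) :
    Tendsto (fun L : ℝ => ∫ y in (-Real.pi)..Real.pi, hankelKernel γ (L + y * Complex.I)) atBot
      (𝓝 0) := by
  refine squeeze_zero_norm
    (a := fun L => Real.exp (Real.exp L + (1 - γ) * L) * |Real.pi - -Real.pi|) (fun L => ?_) ?_
  · refine intervalIntegral.norm_integral_le_of_norm_le_const fun y _ => ?_
    rw [norm_hankelKernel]
    gcongr
    exact mul_le_of_le_one_right (Real.exp_pos _).le (Real.cos_le_one y)
  · have : Tendsto (fun L : ℝ => Real.exp L + (1 - γ) * L) atBot atBot :=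
      Real.tendsto_exp_atBot.add_atBot (tendsto_id.const_mul_atBot (by linarith))
    simpa using (Real.tendsto_exp_atBot.comp this).mul_const |Real.pi - -Real.pi|

lemma tendsto_arc_one :
    Tendsto (fun L : ℝ => ∫ y in (-Real.pi)..Real.pi, hankelKernel 1 (L + y * Complex.I)) atBot
      (𝓝 (2 * Real.pi)) := by
  have h : Tendsto (fun L : ℝ => ∫ y in (-Real.pi)..Real.pi, hankelKernel 1 (L + y * Complex.I))
      atBot (𝓝 (∫ _ in (-Real.pi)..Real.pi, (1 : ℂ))) := by
    refine intervalIntegral.tendsto_integral_filter_of_dominated_convergence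
      (fun _ => Real.exp 1) (Eventually.of_forall fun L => ?_) ?_ (by simp) ?_
    · exact ((differentiable_hankelKernel 1).continuous.comp
        (by fun_prop)).aestronglyMeasurable
    · filter_upwards [eventually_le_atBot 0] with L hL
      refine Eventually.of_forall fun y _ => ?_
      rw [norm_hankelKernel]
      gcongr
      have h1 := mul_le_of_le_one_right (Real.exp_pos L).le (Real.cos_le_one y)
      have h2 := Real.exp_le_one_iff.mpr hL
      linarith
    · refine Eventually.of_forall fun y _ => ?_
      have h1 : Tendsto (fun L : ℝ => Complex.exp (L + y * Complex.I)) atBot (𝓝 0) := by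
        rw [tendsto_zero_iff_norm_tendsto_zero]
        simpa [Complex.norm_exp] using Real.tendsto_exp_atBot
      simpa [hankelKernel, Function.comp_def] using (Complex.continuous_exp.tendsto 0).comp h1
  convert h using 2
  simp
  ring

lemma hankelIntegral_pi_of_lt_one {γ : ℝ} (hγ : γ < 1) (L : ℝ) :
    hankelIntegral Real.pi L (hankelKernel γ) =
      2 * Real.pi * Complex.I * (Complex.Gamma γ)⁻¹ := by
  have ha : 0 < 1 - γ := by linarith
  have hlim : Tendsto (fun R : ℝ => hankelIntegral Real.pi R (hankelKernel γ)) atBot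
      (𝓝 (Complex.exp ((1 - γ : ℝ) * Real.pi * Complex.I) * (Real.Gamma (1 - γ) : ℝ) -
        Complex.exp ((1 - γ : ℝ) * (-Real.pi : ℝ) * Complex.I) * (Real.Gamma (1 - γ) : ℝ) +
        Complex.I * 0)) := by
    unfold hankelIntegral
    simp_rw [rayIntegral_hankelKernel_of_sin_eq_zero (θ := Real.pi) (by simp) (by simp),
      rayIntegral_hankelKernel_of_sin_eq_zero (θ := -Real.pi) (by simp) (by simp)]
    have h := (Complex.continuous_ofReal.tendsto _).comp (tendsto_rayIntegral_real ha)
    exact ((h.const_mul _).sub (h.const_mul _)).add ((tendsto_arc_of_lt_one hγ).const_mul _)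
  have hval := tendsto_nhds_unique (tendsto_const_nhds.congr fun R =>
    hankelIntegral_pi_eq γ L R) hlim
  have hsin : Complex.exp ((1 - γ : ℝ) * Real.pi * Complex.I) -
      Complex.exp ((1 - γ : ℝ) * (-Real.pi : ℝ) * Complex.I) =
      2 * Complex.I * Complex.sin (Real.pi * γ) := by
    have e : Complex.sin (Real.pi * γ) = Complex.sin ((1 - γ : ℝ) * Real.pi) := by
      rw [← Complex.sin_pi_sub]
      push_cast
      ring_nf
    rw [e, Complex.sin]
    push_cast
    linear_combination (Complex.exp ((1 - γ) * Real.pi * Complex.I) -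
      Complex.exp (-((1 - γ) * Real.pi) * Complex.I)) * Complex.I_mul_I +
      congrArg (fun z => Complex.exp z) (by ring :
        -((1 - (γ : ℂ)) * Real.pi) * Complex.I = (1 - γ) * -Real.pi * Complex.I)
  have hrefl := Complex.Gamma_mul_Gamma_one_sub γ
  rw [hval, ← Complex.Gamma_ofReal, mul_zero, add_zero, ← sub_mul, hsin]
  by_cases hs : Complex.sin (Real.pi * γ) = 0
  · have hG : Complex.Gamma γ = 0 := by
      have h1 : Complex.Gamma (1 - γ) ≠ 0 :=
        Complex.Gamma_ne_zero_of_re_pos (by simpa using hγ)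
      rw [hs, _root_.div_zero] at hrefl
      exact (mul_eq_zero.mp hrefl).resolve_right h1
    simp [hs, hG]
  · have hG : Complex.Gamma γ ≠ 0 := by
      intro h0
      rw [h0, zero_mul, eq_comm, _root_.div_eq_zero_iff] at hrefl
      simp [hs, Real.pi_ne_zero] at hrefl
    rw [eq_div_iff hs] at hrefl
    push_cast
    rw [eq_mul_inv_iff_mul_eq₀ hG]
    linear_combination 2 * Complex.I * hrefl

lemma hankelIntegral_pi_one (L : ℝ) :
    hankelIntegral Real.pi L (hankelKernel 1) = 2 * Real.pi * Complex.I := by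
  have h : ∀ R : ℝ, hankelIntegral Real.pi L (hankelKernel 1) =
      Complex.I * ∫ y in (-Real.pi)..Real.pi, hankelKernel 1 (R + y * Complex.I) := by
    intro R
    rw [hankelIntegral_pi_eq 1 L R, hankelIntegral,
      rayIntegral_hankelKernel_of_sin_eq_zero (θ := Real.pi) (by simp) (by simp),
      rayIntegral_hankelKernel_of_sin_eq_zero (θ := -Real.pi) (by simp) (by simp)]
    simp
  have := tendsto_nhds_unique (tendsto_const_nhds.congr h) (tendsto_arc_one.const_mul Complex.I)
  rw [this]
  ring

lemma hasDerivAt_hankelKernel (γ : ℝ) (w : ℂ) :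
    HasDerivAt (hankelKernel γ) (hankelKernel (γ - 1) w + (1 - γ : ℝ) * hankelKernel γ w) w := by
  have h := ((Complex.hasDerivAt_exp w).add
    ((hasDerivAt_id w).const_mul ((1 - γ : ℝ) : ℂ))).cexp
  refine h.congr_deriv ?_
  have e : hankelKernel (γ - 1) w = Complex.exp w * hankelKernel γ w := by
    rw [hankelKernel, hankelKernel, ← Complex.exp_add]
    push_cast
    congr 1
    ring
  rw [e]
  simp only [hankelKernel, id, Pi.add_apply]
  ring

lemma rayIntegral_hankelKernel_deriv {θ : ℝ} (hθ : Real.cos θ < 0) (γ L : ℝ) :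
    rayIntegral θ L (hankelKernel (γ - 1)) + (1 - γ : ℝ) * rayIntegral θ L (hankelKernel γ) =
      -hankelKernel γ (L + θ * Complex.I) := by
  have i1 := rayIntegrable_hankelKernel hθ (γ - 1) L
  have i2 := rayIntegrable_hankelKernel hθ γ L
  unfold RayIntegrable at i1 i2
  unfold rayIntegral
  rw [← integral_const_mul, ← integral_add i1 (i2.const_mul _)]
  have hder : ∀ x : ℝ, HasDerivAt (fun x : ℝ => hankelKernel γ (x + θ * Complex.I))
      (hankelKernel (γ - 1) (x + θ * Complex.I) +
        (1 - γ : ℝ) * hankelKernel γ (x + θ * Complex.I)) x := fun x => by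
    have h1 : HasDerivAt (fun x : ℝ => (x : ℂ) + θ * Complex.I) 1 x :=
      (Complex.ofRealCLM.hasDerivAt (x := x)).add_const _
    simpa [Function.comp_def] using (hasDerivAt_hankelKernel γ (x + θ * Complex.I)).comp x h1
  have ht : Tendsto (fun x : ℝ => hankelKernel γ (x + θ * Complex.I)) atTop (𝓝 0) := by
    rw [tendsto_zero_iff_norm_tendsto_zero]
    simp_rw [norm_hankelKernel]
    exact tendsto_exp_exp_mul_add hθ _
  rw [integral_Ioi_of_hasDerivAt_of_tendsto' (fun x _ => hder x) (i1.add (i2.const_mul _)) ht,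
    zero_sub]

lemma hankelIntegral_hankelKernel_sub_one {θ : ℝ} (hθ : Real.cos θ < 0) (γ L : ℝ) :
    hankelIntegral θ L (hankelKernel (γ - 1)) =
      (γ - 1 : ℝ) * hankelIntegral θ L (hankelKernel γ) := by
  have e1 := rayIntegral_hankelKernel_deriv hθ γ L
  have e2 := rayIntegral_hankelKernel_deriv (θ := -θ) (by simpa using hθ) γ L
  have hii : ∀ δ a b : ℝ, IntervalIntegrable
      (fun y : ℝ => hankelKernel δ (L + y * Complex.I)) volume a b := fun δ a b =>
    ((differentiable_hankelKernel δ).continuous.comp (by fun_prop)).intervalIntegrable _ _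
  have hder : ∀ y : ℝ, HasDerivAt (fun y : ℝ => hankelKernel γ (L + y * Complex.I))
      ((hankelKernel (γ - 1) (L + y * Complex.I) +
        (1 - γ : ℝ) * hankelKernel γ (L + y * Complex.I)) * Complex.I) y := fun y => by
    have h1 : HasDerivAt (fun y : ℝ => (L : ℂ) + y * Complex.I) Complex.I y := by
      simpa using ((Complex.ofRealCLM.hasDerivAt (x := y)).mul_const Complex.I).const_add (L : ℂ)
    exact HasDerivAt.comp (h₂ := hankelKernel γ) y
      (hasDerivAt_hankelKernel γ (L + y * Complex.I)) h1
  have e3 := intervalIntegral.integral_eq_sub_of_hasDerivAt (a := -θ) (b := θ)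
    (fun y _ => hder y) (((hii _ _ _).add ((hii _ _ _).const_mul _)).mul_const _)
  rw [intervalIntegral.integral_mul_const, intervalIntegral.integral_add (hii _ _ _)
    ((hii _ _ _).const_mul _), intervalIntegral.integral_const_mul] at e3
  unfold hankelIntegral
  push_cast at *
  linear_combination e1 - e2 + e3

/-- Hankel's formula for the reciprocal Gamma function at `θ = π`. -/
lemma hankelIntegral_pi (γ L : ℝ) :
    hankelIntegral Real.pi L (hankelKernel γ) =
      2 * Real.pi * Complex.I * (Complex.Gamma γ)⁻¹ := by
  obtain ⟨N, hN⟩ := exists_nat_gt (γ - 1)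
  induction N generalizing γ with
  | zero => exact hankelIntegral_pi_of_lt_one (by simpa using hN) L
  | succ N ih =>
    rcases eq_or_ne γ 1 with rfl | h1
    · simpa using hankelIntegral_pi_one L
    · have h := ih (γ - 1) (by push_cast at hN; linarith)
      rw [hankelIntegral_hankelKernel_sub_one (by simp),
        Complex.one_div_Gamma_eq_self_mul_one_div_Gamma_add_one] at h
      have h2 : ((γ - 1 : ℝ) : ℂ) ≠ 0 := by exact_mod_cast sub_ne_zero.mpr h1
      have h3 : ((γ - 1 : ℝ) : ℂ) + 1 = γ := by push_cast; ring
      rw [h3] at h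
      refine mul_left_cancel₀ h2 ?_
      linear_combination h

/-- Hankel's formula for the reciprocal Gamma function. -/
theorem hankelIntegral_hankelKernel {θ : ℝ} (h1 : Real.pi / 2 < θ) (h2 : θ ≤ Real.pi)
    (γ L : ℝ) :
    hankelIntegral θ L (hankelKernel γ) = 2 * Real.pi * Complex.I * (Complex.Gamma γ)⁻¹ := by
  rw [hankelIntegral_hankelKernel_eq_pi h1 h2, hankelIntegral_pi]

/-- The integrand of the Hankel-type representation of `E_{α,γ}(z)`. -/
noncomputable def mittagLefflerKernel (α γ : ℝ) (z w : ℂ) : ℂ :=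
  hankelKernel γ w * (1 - z * Complex.exp (-α * w))⁻¹

lemma hasSum_integral_mul_geometric {μ : Measure ℝ} {g q : ℝ → ℂ} (hg : Integrable g μ)
    (hq : AEStronglyMeasurable q μ) {ρ : ℝ} (hρ0 : 0 ≤ ρ) (hρ1 : ρ < 1)
    (h : ∀ᵐ x ∂μ, ‖q x‖ ≤ ρ) :
    HasSum (fun k : ℕ => ∫ x, g x * q x ^ k ∂μ) (∫ x, g x * (1 - q x)⁻¹ ∂μ) := by
  refine hasSum_integral_of_dominated_convergence (fun k x => ‖g x‖ * ρ ^ k)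
    (fun k => hg.aestronglyMeasurable.mul (hq.pow k)) (fun k => ?_) (Eventually.of_forall fun x =>
      (summable_geometric_of_lt_one hρ0 hρ1).mul_left _) ?_ ?_
  · filter_upwards [h] with x hx
    rw [norm_mul, norm_pow]
    gcongr
  · simp_rw [tsum_mul_left]
    exact hg.norm.mul_const _
  · filter_upwards [h] with x hx
    exact (hasSum_geometric_of_norm_lt_one (hx.trans_lt hρ1)).mul_left _

lemma hankelIntegral_const_mul (θ L : ℝ) (c : ℂ) (f : ℂ → ℂ) :
    hankelIntegral θ L (fun w => c * f w) = c * hankelIntegral θ L f := by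
  simp only [hankelIntegral, rayIntegral, integral_const_mul, intervalIntegral.integral_const_mul]
  ring

lemma hankelKernel_mul_pow (α γ : ℝ) (z w : ℂ) (k : ℕ) :
    hankelKernel γ w * (z * Complex.exp (-α * w)) ^ k = z ^ k * hankelKernel (α * k + γ) w := by
  rw [mul_pow, ← Complex.exp_nat_mul, mul_left_comm, hankelKernel, hankelKernel, ← Complex.exp_add]
  congr 2
  push_cast
  ring

lemma norm_exp_neg_mul (α x y : ℝ) :
    ‖Complex.exp (-α * (x + y * Complex.I))‖ = Real.exp (-α * x) := by
  rw [Complex.norm_exp]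
  simp

/-- The three integrals forming a Hankel integral sum along with the geometric series. -/
lemma hasSum_hankelIntegral {α θ L : ℝ} (hα : 0 < α) (h1 : Real.pi / 2 < θ) (h2 : θ ≤ Real.pi)
    (γ : ℝ) {z : ℂ} (hz : ‖z‖ * Real.exp (-α * L) < 1) :
    HasSum (fun k : ℕ => hankelIntegral θ L (fun w => hankelKernel γ w *
      (z * Complex.exp (-α * w)) ^ k)) (hankelIntegral θ L (mittagLefflerKernel α γ z)) := by
  have hc : Real.cos θ < 0 := Real.cos_neg_of_pi_div_two_lt_of_lt h1 (by linarith [Real.pi_pos])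
  have hθ : -θ ≤ θ := by linarith [Real.pi_pos]
  have hmeas : ∀ (g : ℝ → ℂ) (μ : Measure ℝ), Continuous g →
      AEStronglyMeasurable (fun x => z * Complex.exp (-α * g x)) μ := fun g μ hg =>
    (by fun_prop : Continuous fun x => z * Complex.exp (-α * g x)).aestronglyMeasurable
  have hbd : ∀ x y : ℝ, L ≤ x → ‖z * Complex.exp (-α * (x + y * Complex.I))‖ ≤
      ‖z‖ * Real.exp (-α * L) := fun x y hx => by
    rw [norm_mul, norm_exp_neg_mul]
    gcongr ‖z‖ * Real.exp ?_
    nlinarith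
  have hray : ∀ η, Real.cos η < 0 → HasSum
      (fun k : ℕ => rayIntegral η L (fun w => hankelKernel γ w *
        (z * Complex.exp (-α * w)) ^ k)) (rayIntegral η L (mittagLefflerKernel α γ z)) :=
    fun η hη => hasSum_integral_mul_geometric (rayIntegrable_hankelKernel hη γ L)
      (hmeas _ _ (by fun_prop)) (by positivity) hz
      ((ae_restrict_mem measurableSet_Ioi).mono fun x hx => hbd x η (le_of_lt hx))
  have harc : HasSum (fun k : ℕ => ∫ y in (-θ)..θ, hankelKernel γ (L + y * Complex.I) *
      (z * Complex.exp (-α * (L + y * Complex.I))) ^ k)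
      (∫ y in (-θ)..θ, mittagLefflerKernel α γ z (L + y * Complex.I)) := by
    simp_rw [intervalIntegral.integral_of_le hθ]
    refine hasSum_integral_mul_geometric ?_ (hmeas _ _ (by fun_prop)) (by positivity) hz
      (Eventually.of_forall fun y => hbd L y le_rfl)
    exact (((differentiable_hankelKernel γ).continuous.comp (by fun_prop)).intervalIntegrable
      (-θ) θ).1
  exact ((hray θ hc).sub (hray (-θ) (by simpa using hc))).add (harc.mul_left Complex.I)

/-- Hankel-type representation of the Mittag-Leffler function. -/
theorem hasSum_mittagLeffler_hankelIntegral {α θ L : ℝ} (hα : 0 < α) (h1 : Real.pi / 2 < θ)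
    (h2 : θ ≤ Real.pi) (γ : ℝ) {z : ℂ} (hz : ‖z‖ * Real.exp (-α * L) < 1) :
    HasSum (fun k : ℕ => z ^ k / Complex.Gamma (((α * k + γ : ℝ) : ℂ)))
      ((2 * Real.pi * Complex.I)⁻¹ * hankelIntegral θ L (mittagLefflerKernel α γ z)) := by
  have h := (hasSum_hankelIntegral hα h1 h2 γ hz).mul_left (2 * Real.pi * Complex.I)⁻¹
  have h0 : (2 * Real.pi * Complex.I : ℂ) ≠ 0 := by simp [Real.pi_ne_zero]
  simp_rw [hankelKernel_mul_pow, hankelIntegral_const_mul, hankelIntegral_hankelKernel h1 h2] at h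
  have e : ∀ a b : ℂ, (2 * Real.pi * Complex.I)⁻¹ * (a * (2 * Real.pi * Complex.I * b⁻¹)) =
      a / b := fun a b => by
    rw [mul_left_comm, inv_mul_cancel_left₀ h0, div_eq_mul_inv]
  simpa only [e] using h

lemma exists_norm_mul_exp_lt_one {α : ℝ} (hα : 0 < α) (z : ℂ) :
    ∃ L : ℝ, 0 ≤ L ∧ ‖z‖ * Real.exp (-α * L) < 1 := by
  have h : Tendsto (fun L : ℝ => ‖z‖ * Real.exp (-α * L)) atTop (𝓝 (‖z‖ * 0)) :=
    (Real.tendsto_exp_atBot.comp (tendsto_id.const_mul_atTop_of_neg (neg_neg_of_pos hα))).const_mul _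
  rw [mul_zero] at h
  exact ((eventually_ge_atTop 0).and (h.eventually_lt_const one_pos)).exists

lemma hasSum_mittagLeffler {α : ℝ} (hα : 0 < α) (γ : ℝ) (z : ℂ) :
    HasSum (fun k : ℕ => z ^ k / Complex.Gamma (((α * k + γ : ℝ) : ℂ))) (mittagLeffler α γ z) := by
  obtain ⟨L, -, hL⟩ := exists_norm_mul_exp_lt_one hα z
  exact (hasSum_mittagLeffler_hankelIntegral hα (by linarith [Real.pi_pos]) le_rfl γ
    hL).summable.hasSum

lemma measurable_mittagLeffler {α : ℝ} (hα : 0 < α) (γ : ℝ) :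
    Measurable (mittagLeffler α γ) := by
  refine measurable_of_tendsto_metrizable (f := fun N z => ∑ k ∈ Finset.range N,
    z ^ k / Complex.Gamma (((α * k + γ : ℝ) : ℂ))) (fun N => by fun_prop) ?_
  exact tendsto_pi_nhds.mpr fun z => (hasSum_mittagLeffler hα γ z).tendsto_sum_nat

lemma mul_mittagLeffler {α : ℝ} (hα : 0 < α) (β : ℝ) (z : ℂ) :
    z * mittagLeffler α β z =
      mittagLeffler α (β - α) z - (Complex.Gamma (((β - α : ℝ) : ℂ)))⁻¹ := by
  have h1 := (hasSum_nat_add_iff' 1).mpr (hasSum_mittagLeffler hα (β - α) z)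
  have h2 := (hasSum_mittagLeffler hα β z).mul_left z
  have e : (fun k : ℕ => z ^ (k + 1) / Complex.Gamma (((α * (k + 1 : ℕ) + (β - α) : ℝ) : ℂ))) =
      fun k : ℕ => z * (z ^ k / Complex.Gamma (((α * k + β : ℝ) : ℂ))) := by
    ext k
    rw [show α * (k + 1 : ℕ) + (β - α) = α * k + β by push_cast; ring]
    ring
  rw [e] at h1
  simpa using h2.unique h1

lemma cos_le_cos_of_le_abs {δ ψ : ℝ} (hδ : 0 ≤ δ) (h1 : δ ≤ |ψ|) (h2 : |ψ| ≤ 2 * Real.pi - δ) :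
    Real.cos ψ ≤ Real.cos δ := by
  rw [← Real.cos_abs ψ]
  rcases le_total |ψ| Real.pi with h | h
  · exact Real.cos_le_cos_of_nonneg_of_le_pi hδ h h1
  · rw [← Real.cos_two_pi_sub]
    exact Real.cos_le_cos_of_nonneg_of_le_pi hδ (by linarith) (by linarith)

lemma sin_le_norm_one_sub {δ ψ ρ : ℝ} (hδ : 0 ≤ δ) (h1 : δ ≤ |ψ|) (h2 : |ψ| ≤ 2 * Real.pi - δ)
    (hρ : 0 ≤ ρ) : Real.sin δ ≤ ‖1 - ρ * Complex.exp (ψ * Complex.I)‖ := by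
  refine le_of_abs_le (abs_le_of_sq_le_sq ?_ (norm_nonneg _))
  rw [← Complex.normSq_eq_norm_sq, Complex.normSq_apply]
  have e1 : (1 - ρ * Complex.exp (ψ * Complex.I)).re = 1 - ρ * Real.cos ψ := by
    simp [Complex.exp_ofReal_mul_I_re]
  have e2 : (1 - ρ * Complex.exp (ψ * Complex.I)).im = -(ρ * Real.sin ψ) := by
    simp [Complex.exp_ofReal_mul_I_im]
  rw [e1, e2]
  have h3 := mul_le_mul_of_nonneg_left (cos_le_cos_of_le_abs hδ h1 h2) hρ
  have e3 : (1 - ρ * Real.cos ψ) * (1 - ρ * Real.cos ψ) +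
      -(ρ * Real.sin ψ) * -(ρ * Real.sin ψ) = 1 - 2 * (ρ * Real.cos ψ) + ρ ^ 2 := by
    linear_combination ρ ^ 2 * Real.sin_sq_add_cos_sq ψ
  rw [e3]
  nlinarith [Real.sin_sq_add_cos_sq δ, sq_nonneg (ρ - Real.cos δ)]

/-- In the closed half-strip the denominator of the kernel stays away from zero, uniformly along
the ray `arg z = φ`. -/
lemma sin_le_norm_one_sub_mul_exp {α θ φ t : ℝ} (hα : 0 < α) (hφ : |φ| ≤ Real.pi)
    (hθ : α * θ ≤ |φ|) (ht : 0 ≤ t) (x : ℝ) {y : ℝ} (hy : |y| ≤ θ) :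
    Real.sin (|φ| - α * θ) ≤ ‖1 - t *
      (Complex.exp (Complex.I * φ) * Complex.exp (-α * (x + y * Complex.I)))‖ := by
  have hay : |α * y| ≤ α * θ := by
    rw [abs_mul, abs_of_pos hα]
    gcongr
  have h1 : |φ| - α * θ ≤ |φ - α * y| := by linarith [abs_sub_abs_le_abs_sub φ (α * y)]
  have h2 : |φ - α * y| ≤ 2 * Real.pi - (|φ| - α * θ) := by linarith [abs_sub φ (α * y)]
  have h := sin_le_norm_one_sub (sub_nonneg.mpr hθ) h1 h2
    (mul_nonneg ht (Real.exp_pos (-α * x)).le)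
  have e : (t : ℂ) * (Complex.exp (Complex.I * φ) * Complex.exp (-α * (x + y * Complex.I))) =
      ((t * Real.exp (-α * x) : ℝ) : ℂ) * Complex.exp ((φ - α * y : ℝ) * Complex.I) := by
    push_cast
    rw [mul_assoc, ← Complex.exp_add, ← Complex.exp_add]
    congr 2
    ring
  rwa [e]

lemma norm_integral_mul_inv_le {μ : Measure ℝ} {g d : ℝ → ℂ} (hg : Integrable g μ) {c : ℝ}
    (hc : 0 < c) (h : ∀ᵐ x ∂μ, c ≤ ‖d x‖) :
    ‖∫ x, g x * (d x)⁻¹ ∂μ‖ ≤ ∫ x, ‖g x‖ * c⁻¹ ∂μ := by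
  refine norm_integral_le_of_norm_le (hg.norm.mul_const _) ?_
  filter_upwards [h] with x hx
  rw [norm_mul, norm_inv]
  gcongr

lemma tendsto_integral_mul_inv_one_sub {μ : Measure ℝ} {g q : ℝ → ℂ} (hg : Integrable g μ)
    (hq : AEStronglyMeasurable q μ) (hq0 : ∀ x, q x ≠ 0) {c : ℝ} (hc : 0 < c)
    (h : ∀ t : ℝ, 0 ≤ t → ∀ᵐ x ∂μ, c ≤ ‖1 - t * q x‖) :
    Tendsto (fun t : ℝ => ∫ x, g x * (1 - t * q x)⁻¹ ∂μ) atTop (𝓝 0) := by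
  have hmain : Tendsto (fun t : ℝ => ∫ x, g x * (1 - t * q x)⁻¹ ∂μ) atTop (𝓝 (∫ _, (0 : ℂ) ∂μ)) := by
    refine tendsto_integral_filter_of_dominated_convergence (fun x => ‖g x‖ * c⁻¹)
      (Eventually.of_forall fun t => ?_) ?_ (hg.norm.mul_const _) (Eventually.of_forall fun x => ?_)
    · exact hg.aestronglyMeasurable.mul
        ((aestronglyMeasurable_const.sub (hq.const_mul _)).aemeasurable.inv.aestronglyMeasurable)
    · filter_upwards [eventually_ge_atTop 0] with t ht
      filter_upwards [h t ht] with x hx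
      rw [norm_mul, norm_inv]
      gcongr
    · have h1 : Tendsto (fun t : ℝ => 1 - (t : ℂ) * q x) atTop (Bornology.cobounded ℂ) := by
        rw [← tendsto_norm_atTop_iff_cobounded]
        refine tendsto_atTop_mono' _ (f₁ := fun t : ℝ => t * ‖q x‖ - 1) ?_ ?_
        · filter_upwards [eventually_ge_atTop 0] with t ht
          have := norm_sub_norm_le ((t : ℂ) * q x) 1
          rw [norm_sub_rev, norm_mul, Complex.norm_real, Real.norm_of_nonneg ht, norm_one] at this
          exact this
        · exact tendsto_atTop_add_const_right _ _
            (tendsto_id.atTop_mul_const (norm_pos_iff.mpr (hq0 x)))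
      simpa using (tendsto_inv₀_cobounded.comp h1).const_mul (g x)
  simpa using hmain

/-- On the ray `arg z = φ`, the left end of the Hankel contour can be moved to `0`. -/
lemma mittagLeffler_eq_hankelIntegral {α θ φ : ℝ} (hα : 0 < α) (h1 : Real.pi / 2 < θ)
    (h2 : θ ≤ Real.pi) (hφ : |φ| ≤ Real.pi) (hθ : α * θ < |φ|) (γ : ℝ) {t : ℝ} (ht : 0 < t) :
    mittagLeffler α γ (Complex.exp (Complex.I * φ) * t) = (2 * Real.pi * Complex.I)⁻¹ *
      hankelIntegral θ 0 (mittagLefflerKernel α γ (Complex.exp (Complex.I * φ) * t)) := by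
  have hpi := Real.pi_pos
  have hc : Real.cos θ < 0 := Real.cos_neg_of_pi_div_two_lt_of_lt h1 (by linarith)
  have hδ : 0 < Real.sin (|φ| - α * θ) :=
    Real.sin_pos_of_pos_of_lt_pi (by linarith) (by nlinarith)
  obtain ⟨L, hL0, hL⟩ := exists_norm_mul_exp_lt_one hα (Complex.exp (Complex.I * φ) * t)
  have hden : ∀ (x : ℝ) {y : ℝ}, |y| ≤ θ → Real.sin (|φ| - α * θ) ≤
      ‖1 - Complex.exp (Complex.I * φ) * t * Complex.exp (-α * (x + y * Complex.I))‖ :=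
    fun x y hy => by
      rw [mul_comm (Complex.exp _) (t : ℂ), mul_assoc]
      exact sin_le_norm_one_sub_mul_exp hα hφ hθ.le ht.le x hy
  have hray : ∀ η, |η| = θ → Real.cos η < 0 →
      RayIntegrable η 0 (mittagLefflerKernel α γ (Complex.exp (Complex.I * φ) * t)) := by
    intro η hη hcη
    have hg := rayIntegrable_hankelKernel hcη γ 0
    unfold RayIntegrable at hg ⊢
    refine (hg.norm.mul_const (Real.sin (|φ| - α * θ))⁻¹).mono'
      (hg.aestronglyMeasurable.mul (Measurable.aestronglyMeasurable (by fun_prop)))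
      (Eventually.of_forall fun x => ?_)
    rw [mittagLefflerKernel, norm_mul, norm_inv]
    gcongr
    exact hden x hη.le
  rw [hankelIntegral_eq_of_le (by linarith) hL0 (fun w hw => ?_)
    (hray θ (abs_of_pos (by linarith)) hc)
    (hray (-θ) (by rw [abs_neg, abs_of_pos (by linarith)]) (by simpa using hc))]
  · exact (hasSum_mittagLeffler hα γ _).unique
      (hasSum_mittagLeffler_hankelIntegral hα h1 h2 γ hL)
  · have h := hden w.re hw
    rw [Complex.re_add_im] at h
    refine (differentiable_hankelKernel γ w).mul (DifferentiableAt.inv (by fun_prop) ?_)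
    exact norm_pos_iff.mp (hδ.trans_le h)

lemma tendsto_mittagLeffler_and_bounded {α φ : ℝ} (hα0 : 0 < α)
    (hφ : |φ| ≤ Real.pi) (hφα : α * Real.pi / 2 < |φ|) (γ : ℝ) :
    Tendsto (fun t : ℝ => mittagLeffler α γ (Complex.exp (Complex.I * φ) * t)) atTop (𝓝 0) ∧
      ∃ C, ∀ t : ℝ, 0 < t → ‖mittagLeffler α γ (Complex.exp (Complex.I * φ) * t)‖ ≤ C := by
  have hpi := Real.pi_pos
  obtain ⟨θ, h1, hθ⟩ : ∃ θ, Real.pi / 2 < θ ∧ θ < min Real.pi (|φ| / α) := by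
    refine exists_between (lt_min (by linarith) ?_)
    rw [lt_div_iff₀ hα0]
    linarith
  obtain ⟨h2, h3⟩ := lt_min_iff.mp hθ
  rw [lt_div_iff₀ hα0, mul_comm] at h3
  have hθθ : -θ ≤ θ := by linarith
  have hc : Real.cos θ < 0 := Real.cos_neg_of_pi_div_two_lt_of_lt h1 (by linarith)
  have hc' : Real.cos (-θ) < 0 := by simpa using hc
  have hδ : 0 < Real.sin (|φ| - α * θ) :=
    Real.sin_pos_of_pos_of_lt_pi (by linarith) (by nlinarith)
  have habs : |θ| ≤ θ := (abs_of_pos (by linarith)).le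
  have habs' : |-θ| ≤ θ := by rwa [abs_neg]
  let q : ℂ → ℂ := fun w => Complex.exp (Complex.I * φ) * Complex.exp (-α * w)
  have hq0 : ∀ w, q w ≠ 0 := fun w => mul_ne_zero (Complex.exp_ne_zero _) (Complex.exp_ne_zero _)
  have hqc : Continuous q := by fun_prop
  have hk : ∀ (t : ℝ) (w : ℂ), mittagLefflerKernel α γ (Complex.exp (Complex.I * φ) * t) w =
      hankelKernel γ w * (1 - t * q w)⁻¹ := fun t w => by
    simp only [mittagLefflerKernel, q]
    ring_nf
  have hden : ∀ t : ℝ, 0 ≤ t → ∀ x y : ℝ, |y| ≤ θ →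
      Real.sin (|φ| - α * θ) ≤ ‖1 - t * q (x + y * Complex.I)‖ := fun t ht x y hy =>
    sin_le_norm_one_sub_mul_exp hα0 hφ h3.le ht x hy
  have harc : Integrable (fun y : ℝ => hankelKernel γ ((0 : ℝ) + y * Complex.I))
      (volume.restrict (Set.Ioc (-θ) θ)) :=
    (((differentiable_hankelKernel γ).continuous.comp (by fun_prop)).intervalIntegrable (-θ) θ).1
  have hdarc : ∀ t : ℝ, 0 ≤ t → ∀ᵐ y : ℝ ∂volume.restrict (Set.Ioc (-θ) θ),
      Real.sin (|φ| - α * θ) ≤ ‖1 - t * q ((0 : ℝ) + y * Complex.I)‖ := fun t ht =>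
    (ae_restrict_mem measurableSet_Ioc).mono fun y hy => hden t ht 0 y (abs_le.mpr ⟨hy.1.le, hy.2⟩)
  have hrep : ∀ t : ℝ, 0 < t → mittagLeffler α γ (Complex.exp (Complex.I * φ) * t) =
      (2 * Real.pi * Complex.I)⁻¹ *
        (rayIntegral θ 0 (fun w => hankelKernel γ w * (1 - t * q w)⁻¹) -
        rayIntegral (-θ) 0 (fun w => hankelKernel γ w * (1 - t * q w)⁻¹) +
        Complex.I * ∫ y in Set.Ioc (-θ) θ, hankelKernel γ ((0 : ℝ) + y * Complex.I) *
          (1 - t * q ((0 : ℝ) + y * Complex.I))⁻¹) := fun t ht => by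
    rw [mittagLeffler_eq_hankelIntegral hα0 h1 h2.le hφ h3 γ ht, funext (hk t), hankelIntegral,
      intervalIntegral.integral_of_le hθθ]
  constructor
  · have hr : ∀ η, |η| ≤ θ → Real.cos η < 0 → Tendsto (fun t : ℝ =>
        rayIntegral η 0 (fun w => hankelKernel γ w * (1 - t * q w)⁻¹)) atTop (𝓝 0) :=
      fun η hη hcη => tendsto_integral_mul_inv_one_sub (rayIntegrable_hankelKernel hcη γ 0)
        (hqc.comp (by fun_prop)).aestronglyMeasurable (fun x => hq0 _) hδ
        fun t ht => Eventually.of_forall fun x => hden t ht x η hη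
    have ha := tendsto_integral_mul_inv_one_sub harc
      (hqc.comp (by fun_prop)).aestronglyMeasurable (fun x => hq0 _) hδ hdarc
    have hlim := (((hr θ habs hc).sub (hr (-θ) habs' hc')).add
      (ha.const_mul Complex.I)).const_mul (2 * Real.pi * Complex.I : ℂ)⁻¹
    rw [sub_zero, mul_zero, add_zero, mul_zero] at hlim
    refine hlim.congr' ?_
    filter_upwards [eventually_gt_atTop 0] with t ht
    exact (hrep t ht).symm
  · have hr : ∀ η, |η| ≤ θ → Real.cos η < 0 → ∃ C, ∀ t : ℝ, 0 < t →
        ‖rayIntegral η 0 (fun w => hankelKernel γ w * (1 - t * q w)⁻¹)‖ ≤ C :=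
      fun η hη hcη => ⟨_, fun t ht => norm_integral_mul_inv_le (rayIntegrable_hankelKernel hcη γ 0)
        hδ (Eventually.of_forall fun x => hden t ht.le x η hη)⟩
    obtain ⟨C₁, hC₁⟩ := hr θ habs hc
    obtain ⟨C₂, hC₂⟩ := hr (-θ) habs' hc'
    refine ⟨‖(2 * Real.pi * Complex.I : ℂ)⁻¹‖ * (C₁ + C₂ +
      ∫ y in Set.Ioc (-θ) θ, ‖hankelKernel γ ((0 : ℝ) + y * Complex.I)‖ *
        (Real.sin (|φ| - α * θ))⁻¹), fun t ht => ?_⟩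
    rw [hrep t ht, norm_mul]
    refine mul_le_mul_of_nonneg_left ((norm_add_le _ _).trans (add_le_add
      ((norm_sub_le _ _).trans (add_le_add (hC₁ t ht) (hC₂ t ht))) ?_)) (norm_nonneg _)
    rw [norm_mul, Complex.norm_I, one_mul]
    exact norm_integral_mul_inv_le harc hδ (hdarc t ht.le)

/-- Decay of the Mittag-Leffler function outside the sector `|arg z| ≤ απ/2`. -/
theorem tendsto_mul_mittagLeffler_and_bounded {α φ : ℝ} (hα0 : 0 < α)
    (hφ : |φ| ≤ Real.pi) (hφα : α * Real.pi / 2 < |φ|) (β : ℝ) :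
    Tendsto (fun t : ℝ => (t : ℂ) * mittagLeffler α β (Complex.exp (Complex.I * φ) * t)) atTop
      (𝓝 (-(Complex.exp (-Complex.I * φ) / Complex.Gamma (((β - α : ℝ) : ℂ))))) ∧
      ∃ C, ∀ t : ℝ, 0 < t →
        ‖(t : ℂ) * mittagLeffler α β (Complex.exp (Complex.I * φ) * t)‖ ≤ C := by
  obtain ⟨hlim, C, hC⟩ := tendsto_mittagLeffler_and_bounded hα0 hφ hφα (β - α)
  have hrep : ∀ t : ℝ, (t : ℂ) * mittagLeffler α β (Complex.exp (Complex.I * φ) * t) =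
      Complex.exp (-Complex.I * φ) * (mittagLeffler α (β - α) (Complex.exp (Complex.I * φ) * t) -
        (Complex.Gamma (((β - α : ℝ) : ℂ)))⁻¹) := fun t => by
    rw [← mul_mittagLeffler hα0, ← mul_assoc, ← mul_assoc, ← Complex.exp_add]
    simp
  simp_rw [hrep]
  constructor
  · convert (hlim.sub_const (Complex.Gamma (((β - α : ℝ) : ℂ)))⁻¹).const_mul
      (Complex.exp (-Complex.I * φ)) using 2
    ring
  · refine ⟨‖Complex.exp (-Complex.I * φ)‖ * (C + ‖(Complex.Gamma (((β - α : ℝ) : ℂ)))⁻¹‖),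
      fun t ht => ?_⟩
    rw [norm_mul]
    gcongr
    exact (norm_sub_le _ _).trans (by gcongr; exact hC t ht)

lemma measurable_besselJ (lam : ℂ) : Measurable (besselJ lam) := by
  have h : Measurable fun r : ℝ => ∫ s in (-1 : ℝ)..1, Complex.exp (Complex.I * r * s) *
      (((1 - s ^ 2 : ℝ)) : ℂ) ^ (lam - 1 / 2) := by
    simp_rw [intervalIntegral.integral_of_le (show (-1 : ℝ) ≤ 1 by norm_num)]
    refine StronglyMeasurable.measurable (StronglyMeasurable.integral_prod_right' (f := fun p : ℝ × ℝ =>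
      Complex.exp (Complex.I * p.1 * p.2) * (((1 - p.2 ^ 2 : ℝ)) : ℂ) ^ (lam - 1 / 2)) ?_)
    exact Measurable.stronglyMeasurable (by fun_prop)
  unfold besselJ
  fun_prop

lemma measurable_besselJbar (n : ℕ) : Measurable (besselJbar n) := by
  have h1 : Measurable besselJNegHalf := by
    unfold besselJNegHalf
    fun_prop
  have h2 := measurable_besselJ ((n : ℂ) / 2 - 1)
  unfold besselJbar
  split_ifs <;> fun_prop

lemma norm_besselJ_le (lam : ℂ) : ∃ C, ∀ r : ℝ, 0 < r → ‖besselJ lam r‖ ≤ C * r ^ lam.re := by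
  refine ⟨‖(2 : ℂ) ^ (-lam)‖ / ‖Complex.Gamma (1 / 2) * Complex.Gamma (lam + 1 / 2)‖ *
    ∫ s in (-1 : ℝ)..1, ‖(((1 - s ^ 2 : ℝ)) : ℂ) ^ (lam - 1 / 2)‖, fun r hr => ?_⟩
  have h : ‖∫ s in (-1 : ℝ)..1, Complex.exp (Complex.I * r * s) *
      (((1 - s ^ 2 : ℝ)) : ℂ) ^ (lam - 1 / 2)‖ ≤
      ∫ s in (-1 : ℝ)..1, ‖(((1 - s ^ 2 : ℝ)) : ℂ) ^ (lam - 1 / 2)‖ := by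
    refine (intervalIntegral.norm_integral_le_integral_norm (by norm_num)).trans_eq ?_
    refine intervalIntegral.integral_congr fun s _ => ?_
    simp [Complex.norm_exp]
  rw [besselJ, norm_mul, norm_div, norm_mul, Complex.norm_cpow_eq_rpow_re_of_pos hr]
  refine (mul_le_mul_of_nonneg_left h (by positivity)).trans_eq ?_
  ring

lemma norm_besselJbar_le {n : ℕ} : ∃ C, ∀ r : ℝ, 0 < r → ‖besselJbar n r‖ ≤ C * r ^ ((n : ℝ) - 1) := by
  by_cases h1 : n = 1
  · subst h1
    refine ⟨Real.sqrt (2 / Real.pi) * (2 * Real.pi) ^ (-(1 / 2) : ℝ), fun r hr => ?_⟩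
    rw [besselJbar, if_pos rfl, besselJNegHalf, ← Complex.ofReal_mul, Complex.norm_real,
      Real.mul_rpow (by positivity) hr.le, norm_mul, norm_mul,
      Real.norm_of_nonneg (by positivity : 0 ≤ r ^ (((1 : ℕ) : ℝ) / 2)),
      Real.norm_of_nonneg (by positivity)]
    have e : r ^ (-(1 / 2) : ℝ) * r ^ (((1 : ℕ) : ℝ) / 2) = r ^ (((1 : ℕ) : ℝ) - 1) := by
      rw [← Real.rpow_add hr]
      norm_num
    rw [← e, Real.norm_eq_abs]
    have hcos := Real.abs_cos_le_one (2 * Real.pi * r)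
    calc _ ≤ Real.sqrt (2 / Real.pi) * ((2 * Real.pi) ^ (-(1 / 2) : ℝ) * r ^ (-(1 / 2) : ℝ)) * 1 *
          r ^ (((1 : ℕ) : ℝ) / 2) := by gcongr
      _ = _ := by ring
  · obtain ⟨C, hC⟩ := norm_besselJ_le ((n : ℂ) / 2 - 1)
    refine ⟨C * (2 * Real.pi) ^ ((n : ℝ) / 2 - 1), fun r hr => ?_⟩
    have h := hC (2 * Real.pi * r) (by positivity)
    have e0 : ((n : ℂ) / 2 - 1).re = (n : ℝ) / 2 - 1 := by simp
    rw [e0, Real.mul_rpow (by positivity) hr.le] at h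
    have e : r ^ ((n : ℝ) - 1) = r ^ ((n : ℝ) / 2 - 1) * r ^ ((n : ℝ) / 2) := by
      rw [← Real.rpow_add hr]
      ring_nf
    rw [besselJbar, if_neg h1, norm_mul, Complex.norm_real,
      Real.norm_of_nonneg (by positivity : 0 ≤ r ^ ((n : ℝ) / 2)), e]
    refine (mul_le_mul_of_nonneg_right h (by positivity)).trans_eq ?_
    ring

lemma integrableOn_cutoff_mul_besselJbar {n : ℕ} {σ : ℝ} {φ₀ : ℝ → ℝ} (hmeas : Measurable φ₀)
    (hrange : ∀ r, 0 ≤ φ₀ r ∧ φ₀ r ≤ 1) (hsupp : Function.support φ₀ ⊆ Set.Icc (-2 : ℝ) 2)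
    (hσn : σ < n) :
    IntegrableOn (fun r : ℝ => ((φ₀ r : ℝ) : ℂ) * besselJbar n r * ((r ^ (-σ) : ℝ) : ℂ))
      (Set.Ioi 0) := by
  obtain ⟨C, hC⟩ := norm_besselJbar_le (n := n)
  have hJ := measurable_besselJbar n
  have h1 : IntegrableOn (fun r : ℝ => C * r ^ ((n : ℝ) - 1 - σ)) (Set.Ioc 0 2) :=
    ((intervalIntegral.intervalIntegrable_rpow' (by linarith)).1).const_mul C
  have h2 : IntegrableOn (fun r : ℝ => ((φ₀ r : ℝ) : ℂ) * besselJbar n r * ((r ^ (-σ) : ℝ) : ℂ))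
      (Set.Ioc 0 2) := by
    refine Integrable.mono' h1 (Measurable.aestronglyMeasurable (by fun_prop)) ?_
    filter_upwards [ae_restrict_mem measurableSet_Ioc] with r hr
    have hr0 : 0 < r := hr.1
    rw [norm_mul, norm_mul, Complex.norm_real, Complex.norm_real,
      Real.norm_of_nonneg (hrange r).1, Real.norm_of_nonneg (by positivity : 0 ≤ r ^ (-σ)),
      sub_eq_add_neg _ σ, Real.rpow_add hr0, ← mul_assoc]
    exact mul_le_mul_of_nonneg_right
      ((mul_le_of_le_one_left (norm_nonneg _) (hrange r).2).trans (hC r hr0)) (by positivity)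
  refine h2.of_forall_sdiff_eq_zero measurableSet_Ioi fun r hr => ?_
  have : φ₀ r = 0 := by
    by_contra h0
    exact hr.2 ⟨hr.1, (hsupp h0).2⟩
  simp [this]

theorem stmt7 (n : ℕ) (hn : 1 ≤ n) (α β σ φ : ℝ)
    (hα0 : 0 < α) (hα2 : α < 2) (hβ : 0 < β) (hσ0 : 0 < σ)
    (hφ1 : -Real.pi < φ) (hφ2 : φ ≤ Real.pi) (hφα : α * Real.pi / 2 < |φ|) (φ₀ : ℝ → ℝ) (hcut_smooth : ContDiff ℝ (⊤ : ℕ∞) φ₀)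
    (hcut_range : ∀ r, 0 ≤ φ₀ r ∧ φ₀ r ≤ 1)
    (hcut_one : ∀ r ∈ Set.Icc (-1:ℝ) 1, φ₀ r = 1)
    (hcut_supp : Function.support φ₀ ⊆ Set.Icc (-2:ℝ) 2)
    (hσn : σ < n) :
    Tendsto (fun ξ : EuclideanSpace ℝ (Fin n) => ((‖ξ‖ ^ (-σ) : ℝ) : ℂ) * Mfun n α β σ φ φ₀ ξ)
      (𝓝[≠] 0)
      (𝓝 (-(Complex.exp (-(Complex.I) * φ) / Complex.Gamma (((β - α : ℝ) : ℂ))) *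
        ∫ r in Set.Ioi (0:ℝ), ((φ₀ r : ℝ) : ℂ) * besselJbar n r * ((r ^ (-σ) : ℝ) : ℂ))) := by
  have hφ : |φ| ≤ Real.pi := abs_le.mpr ⟨hφ1.le, hφ2⟩
  obtain ⟨hlim, C, hC⟩ := tendsto_mul_mittagLeffler_and_bounded hα0 hφ hφα β
  have hint := integrableOn_cutoff_mul_besselJbar hcut_smooth.continuous.measurable hcut_range
    hcut_supp hσn
  have hE := measurable_mittagLeffler hα0 β
  have hJ := measurable_besselJbar n
  have hcut := hcut_smooth.continuous.measurable
  simp_rw [Mfun, ← integral_const_mul]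
  have hrw : ∀ (ξ : EuclideanSpace ℝ (Fin n)) (r : ℝ), ξ ≠ 0 → 0 < r →
      ((‖ξ‖ ^ (-σ) : ℝ) : ℂ) * (((φ₀ r : ℝ) : ℂ) *
        mittagLeffler α β (Complex.exp (Complex.I * φ) * ((r ^ σ / ‖ξ‖ ^ σ : ℝ) : ℂ)) *
        besselJbar n r) =
      ((r ^ σ / ‖ξ‖ ^ σ : ℝ) : ℂ) *
        mittagLeffler α β (Complex.exp (Complex.I * φ) * ((r ^ σ / ‖ξ‖ ^ σ : ℝ) : ℂ)) *
        (((φ₀ r : ℝ) : ℂ) * besselJbar n r * ((r ^ (-σ) : ℝ) : ℂ)) := fun ξ r hξ hr => by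
    have e : ‖ξ‖ ^ (-σ) = r ^ σ / ‖ξ‖ ^ σ * r ^ (-σ) := by
      have := (Real.rpow_pos_of_pos hr σ).ne'
      rw [Real.rpow_neg hr.le, Real.rpow_neg (norm_nonneg ξ)]
      field_simp
    rw [e, Complex.ofReal_mul]
    ring
  refine tendsto_integral_filter_of_dominated_convergence
    (fun r => C * ‖((φ₀ r : ℝ) : ℂ) * besselJbar n r * ((r ^ (-σ) : ℝ) : ℂ)‖)
    (Eventually.of_forall fun ξ => Measurable.aestronglyMeasurable (by fun_prop)) ?_
    (hint.norm.const_mul C) ?_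
  · filter_upwards [self_mem_nhdsWithin] with ξ hξ
    filter_upwards [ae_restrict_mem measurableSet_Ioi] with r hr
    rw [hrw ξ r hξ hr, norm_mul]
    have := norm_pos_iff.mpr hξ
    have hr0 : 0 < r := hr
    gcongr
    exact hC _ (by positivity)
  · filter_upwards [ae_restrict_mem measurableSet_Ioi] with r hr
    have ht : Tendsto (fun ξ : EuclideanSpace ℝ (Fin n) => r ^ σ / ‖ξ‖ ^ σ) (𝓝[≠] 0) atTop := by
      have h1 := (tendsto_rpow_neg_nhdsGT_zero (neg_neg_of_pos hσ0)).comp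
        (tendsto_norm_nhdsNE_zero (E := EuclideanSpace ℝ (Fin n)))
      refine (h1.const_mul_atTop (Real.rpow_pos_of_pos hr σ)).congr fun ξ => ?_
      simp [Real.rpow_neg (norm_nonneg ξ), div_eq_mul_inv]
    refine ((hlim.comp ht).mul_const _).congr' ?_
    filter_upwards [self_mem_nhdsWithin] with ξ hξ
    exact (hrw ξ r hξ hr).symm
end

section
/- Let ξ ∈ ℝⁿ \ {0} be fixed and let j ≥ 1 be an integer. Then lim_{r→∞} r^{σj} ∮_ω e^{z^{1/α}} z^{(1−β)/α} (z − e^{iφ} r^σ/|ξ|^σ)^{−j} dz = (−1)^j e^{−ijφ} |ξ|^{σj} ∮_ω e^{z^{1/α}} z^{(1−β)/α} dz. -/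
open MeasureTheory Filter Real Complex Topology ENNReal

/-- The contour integral `∮_ω F(z) dz` over the contour `C_ω` consisting of the two rays
`{ρ e^{±iω} : ρ ≥ 1}` and the arc `{e^{iθ} : |θ| ≤ ω}`:
`∮_ω F = ∫₁^∞ F(ρe^{iω}) e^{iω} dρ − ∫₁^∞ F(ρe^{−iω}) e^{−iω} dρ + i ∫_{−ω}^{ω} F(e^{iθ}) e^{iθ} dθ`. -/
noncomputable def contourIntegral (ω : ℝ) (F : ℂ → ℂ) : ℂ :=
  (∫ ρ in Set.Ioi (1:ℝ), F ((ρ : ℂ) * Complex.exp (Complex.I * ω)) * Complex.exp (Complex.I * ω))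
  - (∫ ρ in Set.Ioi (1:ℝ),
      F ((ρ : ℂ) * Complex.exp (-(Complex.I) * ω)) * Complex.exp (-(Complex.I) * ω))
  + Complex.I * ∫ θ in (-ω)..ω, F (Complex.exp (Complex.I * θ)) * Complex.exp (Complex.I * θ)

/-- The kernel `z ↦ e^{z^{1/α}} z^{(1−β)/α}`, with principal complex powers. -/
noncomputable def mlKer (a b : ℝ) (z : ℂ) : ℂ :=
  Complex.exp (z ^ (((1 / a : ℝ)) : ℂ)) * z ^ ((((1 - b) / a : ℝ)) : ℂ)

/-- Dominated convergence for the resolvent factor `R ^ j (γ - u R) ^ (-j)` as `R → ∞`. -/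
theorem tendsto_pow_mul_integral_mul_inv_sub_pow {X : Type*} [MeasurableSpace X] {μ : Measure X}
    {k γ : X → ℂ} (hk : Integrable k μ) (hγ : Measurable γ) {u : ℂ} (hu : u ≠ 0) {c : ℝ}
    (hc : 0 < c) (hb : ∀ᶠ R : ℝ in atTop, ∀ᵐ x ∂μ, c * R ≤ ‖γ x - u * (R : ℂ)‖) (j : ℕ) :
    Tendsto (fun R : ℝ => (R : ℂ) ^ j * ∫ x, k x * ((γ x - u * (R : ℂ)) ^ j)⁻¹ ∂μ) atTop
      (𝓝 (((-u) ^ j)⁻¹ * ∫ x, k x ∂μ)) := by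
  simp_rw [← integral_const_mul]
  refine tendsto_integral_filter_of_dominated_convergence (fun x => (c⁻¹) ^ j * ‖k x‖) ?_ ?_ ?_ ?_
  · refine .of_forall fun R => ?_
    refine AEStronglyMeasurable.const_mul (hk.1.mul ?_) _
    exact Measurable.aestronglyMeasurable (by fun_prop)
  · filter_upwards [hb, eventually_gt_atTop 0] with R hR hR0
    filter_upwards [hR] with x hx
    have h1 : R * ‖γ x - u * (R : ℂ)‖⁻¹ ≤ c⁻¹ := by
      have h2 : 0 < c * R := by positivity
      rw [← div_eq_mul_inv, div_le_iff₀ (h2.trans_le hx), inv_mul_eq_div, le_div_iff₀ hc]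
      linarith
    calc ‖(R : ℂ) ^ j * (k x * ((γ x - u * (R : ℂ)) ^ j)⁻¹)‖
        = (R * ‖γ x - u * (R : ℂ)‖⁻¹) ^ j * ‖k x‖ := by
          rw [norm_mul, norm_mul, norm_inv, norm_pow, norm_pow, Complex.norm_real,
            Real.norm_of_nonneg hR0.le, mul_pow, inv_pow]
          ring
      _ ≤ _ := by gcongr
  · exact hk.norm.const_mul _
  · refine .of_forall fun x => ?_
    have h1 : Tendsto (fun R : ℝ => γ x * ((R⁻¹ : ℝ) : ℂ) - u) atTop (𝓝 (-u)) := by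
      have h2 : Tendsto (fun R : ℝ => ((R⁻¹ : ℝ) : ℂ)) atTop (𝓝 ((0 : ℝ) : ℂ)) :=
        (Complex.continuous_ofReal.tendsto 0).comp tendsto_inv_atTop_zero
      simpa using (h2.const_mul (γ x)).sub_const u
    have h3 := ((h1.pow j).inv₀ (pow_ne_zero j (neg_ne_zero.2 hu))).mul_const (k x)
    refine h3.congr' ?_
    filter_upwards [eventually_gt_atTop 0] with R hR
    have hR' : (R : ℂ) ≠ 0 := by exact_mod_cast hR.ne'
    have h4 : γ x * ((R⁻¹ : ℝ) : ℂ) - u = (γ x - u * (R : ℂ)) * (R : ℂ)⁻¹ := by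
      push_cast
      field_simp
    rw [h4, mul_pow, mul_inv, inv_pow, inv_inv]
    ring

theorem measurable_mlKer (a b : ℝ) : Measurable (mlKer a b) := by
  unfold mlKer
  fun_prop

theorem norm_mlKer (a b : ℝ) (z : ℂ) :
    ‖mlKer a b z‖ = Real.exp (‖z‖ ^ (1 / a) * Real.cos (z.arg * (1 / a))) * ‖z‖ ^ ((1 - b) / a) := by
  rw [mlKer, norm_mul, Complex.norm_exp, Complex.cpow_ofReal_re, Complex.norm_cpow_real]

theorem integrableOn_mlKer_ray {a b : ℝ} (ha : 0 < a) {w : ℝ} (hw : |w| < π)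
    (hcos : Real.cos (w / a) < 0) :
    IntegrableOn (fun ρ : ℝ => mlKer a b ((ρ : ℂ) * Complex.exp (w * Complex.I))) (Set.Ioi 1) := by
  have hI := (integrableOn_rpow_mul_exp_neg_mul_rpow (p := 1 / a)
    (s := |(1 - b) / a|) (by linarith [abs_nonneg ((1 - b) / a)]) (by positivity)
    (neg_pos.2 hcos)).mono_set (Set.Ioi_subset_Ioi zero_le_one)
  refine Integrable.mono' hI ?_ ?_
  · exact ((measurable_mlKer a b).comp (by fun_prop)).aestronglyMeasurable
  · filter_upwards [ae_restrict_mem measurableSet_Ioi] with ρ hρ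
    have hρ1 : 1 < ρ := hρ
    have hρ0 : 0 < ρ := by linarith
    have harg : ((ρ : ℂ) * Complex.exp (w * Complex.I)).arg = w := by
      rw [Complex.arg_real_mul _ hρ0, Complex.arg_exp_mul_I]
      exact (toIocMod_eq_self _).2 ⟨by linarith [(abs_lt.1 hw).1], by linarith [(abs_lt.1 hw).2]⟩
    have hnorm : ‖(ρ : ℂ) * Complex.exp (w * Complex.I)‖ = ρ := by
      rw [norm_mul, Complex.norm_exp_ofReal_mul_I, Complex.norm_real, mul_one,
        Real.norm_of_nonneg hρ0.le]
    rw [norm_mlKer, harg, hnorm, mul_comm, neg_neg, mul_one_div, mul_comm (ρ ^ (1 / a))]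
    gcongr
    exacts [hρ1.le, le_abs_self _]

theorem norm_mlKer_exp_mul_I_le (a b θ : ℝ) :
    ‖mlKer a b (Complex.exp (θ * Complex.I))‖ ≤ Real.exp 1 := by
  rw [norm_mlKer, Complex.norm_exp_ofReal_mul_I, Real.one_rpow, Real.one_rpow, one_mul, mul_one]
  exact Real.exp_le_exp.2 (Real.cos_le_one _)

/-- A unit vector off a ray from the origin stays at positive distance from that ray,
at every scale. -/
theorem exists_pos_mul_le_norm_ray_sub {φ w : ℝ} (h : Real.cos (w - φ) < 1) :
    ∃ c > 0, ∀ R ρ : ℝ, 0 ≤ R → 0 ≤ ρ →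
      c * R ≤ ‖(ρ : ℂ) * Complex.exp (w * Complex.I) - Complex.exp (φ * Complex.I) * (R : ℂ)‖ := by
  refine ⟨√((1 - Real.cos (w - φ)) / 2), Real.sqrt_pos.2 (by linarith), fun R ρ hR hρ => ?_⟩
  refine le_of_sq_le_sq ?_ (norm_nonneg _)
  have h1 : ‖(ρ : ℂ) * Complex.exp (w * Complex.I) - Complex.exp (φ * Complex.I) * (R : ℂ)‖ ^ 2
      = ρ ^ 2 + R ^ 2 - 2 * ρ * R * Real.cos (w - φ) := by
    rw [← Complex.normSq_eq_norm_sq, Complex.normSq_apply, Real.cos_sub]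
    simp [Complex.exp_ofReal_mul_I_re, Complex.exp_ofReal_mul_I_im]
    linear_combination ρ ^ 2 * Real.sin_sq_add_cos_sq w + R ^ 2 * Real.sin_sq_add_cos_sq φ
  rw [h1, mul_pow, Real.sq_sqrt (by linarith)]
  have h2 := Real.neg_one_le_cos (w - φ)
  nlinarith [mul_nonneg (by linarith : 0 ≤ 1 + Real.cos (w - φ)) (sq_nonneg (ρ - R)),
    mul_nonneg (by linarith : 0 ≤ 1 - Real.cos (w - φ)) (mul_nonneg hR hρ),
    mul_nonneg (by linarith : 0 ≤ 1 - Real.cos (w - φ)) (sq_nonneg ρ)]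

/-- Asymptotics of one ray of the contour integral. -/
theorem tendsto_mlKer_ray {a b w φ : ℝ} (ha : 0 < a) (hw : |w| < π)
    (hcos : Real.cos (w / a) < 0) (h : Real.cos (w - φ) < 1) (j : ℕ) :
    Tendsto (fun R : ℝ => (R : ℂ) ^ j * ∫ ρ in Set.Ioi (1 : ℝ),
        mlKer a b ((ρ : ℂ) * Complex.exp (w * Complex.I)) *
          (((ρ : ℂ) * Complex.exp (w * Complex.I) - Complex.exp (φ * Complex.I) * (R : ℂ)) ^ j)⁻¹ *
          Complex.exp (w * Complex.I)) atTop
      (𝓝 (((-Complex.exp (φ * Complex.I)) ^ j)⁻¹ * ∫ ρ in Set.Ioi (1 : ℝ),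
        mlKer a b ((ρ : ℂ) * Complex.exp (w * Complex.I)) * Complex.exp (w * Complex.I))) := by
  obtain ⟨c, hc, hb⟩ := exists_pos_mul_le_norm_ray_sub h
  simp_rw [mul_right_comm _ _ (Complex.exp (w * Complex.I))]
  refine tendsto_pow_mul_integral_mul_inv_sub_pow
    ((integrableOn_mlKer_ray ha hw hcos).mul_const _) (by fun_prop) (Complex.exp_ne_zero _) hc ?_ j
  filter_upwards [eventually_ge_atTop 0] with R hR
  filter_upwards [ae_restrict_mem measurableSet_Ioi] with ρ hρ
  exact hb R ρ hR (zero_le_one.trans (le_of_lt hρ))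

/-- Asymptotics of the circular arc of the contour integral. -/
theorem tendsto_mlKer_arc {a b φ w : ℝ} (hw : 0 ≤ w) (j : ℕ) :
    Tendsto (fun R : ℝ => (R : ℂ) ^ j * ∫ θ in (-w)..w,
        mlKer a b (Complex.exp (θ * Complex.I)) *
          ((Complex.exp (θ * Complex.I) - Complex.exp (φ * Complex.I) * (R : ℂ)) ^ j)⁻¹ *
          Complex.exp (θ * Complex.I)) atTop
      (𝓝 (((-Complex.exp (φ * Complex.I)) ^ j)⁻¹ * ∫ θ in (-w)..w,
        mlKer a b (Complex.exp (θ * Complex.I)) * Complex.exp (θ * Complex.I))) := by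
  simp_rw [mul_right_comm _ _ (Complex.exp (_ * Complex.I)),
    intervalIntegral.integral_of_le (neg_le_self hw)]
  refine tendsto_pow_mul_integral_mul_inv_sub_pow ?_ (by fun_prop) (Complex.exp_ne_zero _)
    (one_half_pos (α := ℝ)) ?_ j
  · refine Integrable.of_bound (C := Real.exp 1) ?_ (.of_forall fun θ => ?_)
    · exact (((measurable_mlKer a b).comp (by fun_prop)).mul
        (by fun_prop)).aestronglyMeasurable
    · rw [norm_mul, Complex.norm_exp_ofReal_mul_I, mul_one]
      exact norm_mlKer_exp_mul_I_le a b θ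
  · filter_upwards [eventually_ge_atTop 2] with R hR
    refine .of_forall fun θ => ?_
    have h1 := norm_sub_norm_le (Complex.exp (φ * Complex.I) * (R : ℂ))
      (Complex.exp (θ * Complex.I))
    rw [norm_mul, Complex.norm_exp_ofReal_mul_I, Complex.norm_exp_ofReal_mul_I, Complex.norm_real,
      Real.norm_of_nonneg (by linarith), norm_sub_rev] at h1
    linarith

theorem contourIntegral_eq (w : ℝ) (F : ℂ → ℂ) : contourIntegral w F =
    (∫ ρ in Set.Ioi (1 : ℝ), F ((ρ : ℂ) * Complex.exp (w * Complex.I)) *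
      Complex.exp (w * Complex.I)) -
    (∫ ρ in Set.Ioi (1 : ℝ), F ((ρ : ℂ) * Complex.exp ((-w : ℝ) * Complex.I)) *
      Complex.exp ((-w : ℝ) * Complex.I)) +
    Complex.I * ∫ θ in (-w)..w, F (Complex.exp (θ * Complex.I)) *
      Complex.exp (θ * Complex.I) := by
  have h : -Complex.I * (w : ℂ) = (-w : ℝ) * Complex.I := by
    push_cast
    ring
  simp only [contourIntegral, h, mul_comm Complex.I (Complex.ofReal _)]

theorem tendsto_contourIntegral_mlKer {a b w φ : ℝ} (ha : 0 < a) (hw0 : 0 ≤ w) (hw : w < π)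
    (hcos : Real.cos (w / a) < 0) (hφ : |φ| ≤ π) (hwφ : w < |φ|) (j : ℕ) :
    Tendsto (fun R : ℝ => (R : ℂ) ^ j * contourIntegral w (fun z => mlKer a b z *
        ((z - Complex.exp (φ * Complex.I) * (R : ℂ)) ^ j)⁻¹)) atTop
      (𝓝 (((-Complex.exp (φ * Complex.I)) ^ j)⁻¹ * contourIntegral w (mlKer a b))) := by
  have hcos_lt : ∀ v : ℝ, |v| = w → Real.cos (v - φ) < 1 := fun v hv => by
    refine lt_of_le_of_ne (Real.cos_le_one _) fun h => ?_
    have h1 : |v - φ| < 2 * π := (abs_sub v φ).trans_lt (by linarith)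
    rw [Real.cos_eq_one_iff_of_lt_of_lt (by linarith [(abs_lt.1 h1).1]) (abs_lt.1 h1).2,
      sub_eq_zero] at h
    rw [h] at hv
    linarith
  have h1 := tendsto_mlKer_ray (b := b) ha (by rwa [abs_of_nonneg hw0]) hcos
    (hcos_lt w (abs_of_nonneg hw0)) j
  have h2 := tendsto_mlKer_ray (b := b) (w := -w) ha (by rwa [abs_neg, abs_of_nonneg hw0])
    (by rwa [neg_div, Real.cos_neg]) (hcos_lt (-w) (by rwa [abs_neg, abs_of_nonneg])) j
  have h3 := (tendsto_mlKer_arc (a := a) (b := b) (φ := φ) hw0 j).const_mul Complex.I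
  have h4 := (h1.sub h2).add h3
  simp only [contourIntegral_eq]
  refine (h4.congr fun R => ?_).trans_eq ?_
  · ring
  · congr 1
    ring

theorem stmt14 (n : ℕ) (hn : 1 ≤ n) (α β σ φ : ℝ)
    (hα0 : 0 < α) (hα2 : α < 2) (hβ : 0 < β) (hσ0 : 0 < σ)
    (hφ1 : -Real.pi < φ) (hφ2 : φ ≤ Real.pi) (hφα : α * Real.pi / 2 < |φ|) (ω : ℝ) (hω1 : α * Real.pi / 2 < ω) (hω2 : ω < |φ|) (hω3 : ω < α * Real.pi) (hω4 : ω < Real.pi)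
    (ξ : EuclideanSpace ℝ (Fin n)) (hξ : ξ ≠ 0) (j : ℕ) (hj : 1 ≤ j) :
    Tendsto (fun r : ℝ => ((r ^ (σ * (j : ℝ)) : ℝ) : ℂ) *
        contourIntegral ω (fun z => mlKer α β z *
          ((z - Complex.exp (Complex.I * φ) * ((r ^ σ / ‖ξ‖ ^ σ : ℝ) : ℂ)) ^ j)⁻¹))
      atTop
      (𝓝 ((-1 : ℂ) ^ j * Complex.exp (-(Complex.I) * ((j : ℂ) * φ)) *
        ((‖ξ‖ ^ (σ * (j : ℝ)) : ℝ) : ℂ) * contourIntegral ω (mlKer α β))) := by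
  have hξ0 : 0 < ‖ξ‖ := norm_pos_iff.2 hξ
  have hπ := Real.pi_pos
  have hω0 : 0 < ω := lt_trans (by positivity) hω1
  have hcos : Real.cos (ω / α) < 0 := by
    refine Real.cos_neg_of_pi_div_two_lt_of_lt ?_ ?_
    · rw [lt_div_iff₀ hα0]
      linarith
    · have : ω / α < Real.pi := by
        rw [div_lt_iff₀ hα0]
        linarith
      linarith
  have hmain := tendsto_contourIntegral_mlKer (b := β) hα0 hω0.le hω4 hcos
    (abs_le.2 ⟨hφ1.le, hφ2⟩) hω2 j
  have hR : Tendsto (fun r : ℝ => r ^ σ / ‖ξ‖ ^ σ) atTop atTop :=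
    (tendsto_rpow_atTop hσ0).atTop_div_const (Real.rpow_pos_of_pos hξ0 σ)
  have h := (hmain.comp hR).const_mul ((‖ξ‖ ^ (σ * (j : ℝ)) : ℝ) : ℂ)
  have hlim : ((-Complex.exp (φ * Complex.I)) ^ j)⁻¹ =
      (-1 : ℂ) ^ j * Complex.exp (-(Complex.I) * ((j : ℂ) * φ)) := by
    rw [neg_pow, mul_inv, ← Complex.exp_nat_mul, ← Complex.exp_neg, ← inv_pow, inv_neg_one]
    congr 2
    ring
  rw [hlim, ← mul_assoc, mul_comm (Complex.ofReal _) (_ * _)] at h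
  refine h.congr' ?_
  filter_upwards [eventually_gt_atTop 0] with r hr
  have hpow : ‖ξ‖ ^ (σ * (j : ℝ)) * (r ^ σ / ‖ξ‖ ^ σ) ^ j = r ^ (σ * (j : ℝ)) := by
    rw [Real.rpow_mul_natCast hξ0.le, Real.rpow_mul_natCast hr.le, ← mul_pow,
      mul_div_cancel₀ _ (Real.rpow_pos_of_pos hξ0 σ).ne']
  simp only [Function.comp_apply]
  rw [← mul_assoc, ← Complex.ofReal_pow, ← Complex.ofReal_mul, hpow, mul_comm (φ : ℂ) Complex.I]
end
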